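/- Let k be a field. Take n = 3, F₁ = F₂ = F₃ = k, G₁ = G₂ = G₃ = k³, with f₁ = f₂ = f'₁ = f'₂ = 0, and with g₁, g'₁, g₂, g'₂ : k³ → k³ the diagonal linear maps with diagonal entries (1,0,0), (0,1,1), (1,1,0), (0,0,1) respectively. Then the space of linked tuples (φ₁, φ₂, φ₃) has dimension 4 over k; in particular it exceeds r·m = 1·3 = 3, showing that conditions (I) (with s = 0) and (II) (kernels equal images) alone, without the complementarity condition (III), do not suffice for the linked Hom space to have dimension r·m. -/

import Mathlib

/-!
Statement 11 (the example of Remark 2.5 of Osserman, "Linked Hom spaces",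
over a point, i.e. with `t = 0`, `s = t² = 0`): with `n = 3`, `F₁ = F₂ = F₃ = k`,
`G₁ = G₂ = G₃ = k³`, all the `f`-maps zero, and `g₁, g'₁, g₂, g'₂` the diagonal
maps with entries `(1,0,0)`, `(0,1,1)`, `(1,1,0)`, `(0,0,1)`, the space of
linked tuples has dimension `4 > 1·3 = r·m`.
-/

/-- The diagonal linear map `k³ → k³` with diagonal entries `d`. -/
def diagMap (k : Type*) [Field k] (d : Fin 3 → k) : (Fin 3 → k) →ₗ[k] (Fin 3 → k) :=
  LinearMap.pi fun j => d j • LinearMap.proj j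

/-- The space of linked tuples `(φ₁, φ₂, φ₃)` for the data of Remark 2.5 with
`t = 0`: all `f`-maps are `0`, and `g₁ = diag (1,0,0)`, `g'₁ = diag (0,1,1)`,
`g₂ = diag (1,1,0)`, `g'₂ = diag (0,0,1)`. -/
def linkedTuplesExample (k : Type*) [Field k] :
    Submodule k ((k →ₗ[k] (Fin 3 → k)) × (k →ₗ[k] (Fin 3 → k)) × (k →ₗ[k] (Fin 3 → k))) where
  carrier := {φ |
    -- `φ₂ ∘ f₁ = g₁ ∘ φ₁`:
    φ.2.1.comp (0 : k →ₗ[k] k) = (diagMap k ![1, 0, 0]).comp φ.1 ∧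
    -- `φ₁ ∘ f'₁ = g'₁ ∘ φ₂`:
    φ.1.comp (0 : k →ₗ[k] k) = (diagMap k ![0, 1, 1]).comp φ.2.1 ∧
    -- `φ₃ ∘ f₂ = g₂ ∘ φ₂`:
    φ.2.2.comp (0 : k →ₗ[k] k) = (diagMap k ![1, 1, 0]).comp φ.2.1 ∧
    -- `φ₂ ∘ f'₂ = g'₂ ∘ φ₃`:
    φ.2.1.comp (0 : k →ₗ[k] k) = (diagMap k ![0, 0, 1]).comp φ.2.2}
  add_mem' := by
    rintro a b ⟨ha1, ha2, ha3, ha4⟩ ⟨hb1, hb2, hb3, hb4⟩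
    refine ⟨?_, ?_, ?_, ?_⟩
    · simp only [Prod.fst_add, Prod.snd_add, LinearMap.add_comp, LinearMap.comp_add]
      rw [ha1, hb1]
    · simp only [Prod.fst_add, Prod.snd_add, LinearMap.add_comp, LinearMap.comp_add]
      rw [ha2, hb2]
    · simp only [Prod.fst_add, Prod.snd_add, LinearMap.add_comp, LinearMap.comp_add]
      rw [ha3, hb3]
    · simp only [Prod.fst_add, Prod.snd_add, LinearMap.add_comp, LinearMap.comp_add]
      rw [ha4, hb4]
  zero_mem' := by
    refine ⟨?_, ?_, ?_, ?_⟩ <;> simp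
  smul_mem' := by
    rintro c a ⟨ha1, ha2, ha3, ha4⟩
    refine ⟨?_, ?_, ?_, ?_⟩
    · simp only [Prod.smul_fst, Prod.smul_snd, LinearMap.smul_comp, LinearMap.comp_smul]
      rw [ha1]
    · simp only [Prod.smul_fst, Prod.smul_snd, LinearMap.smul_comp, LinearMap.comp_smul]
      rw [ha2]
    · simp only [Prod.smul_fst, Prod.smul_snd, LinearMap.smul_comp, LinearMap.comp_smul]
      rw [ha3]
    · simp only [Prod.smul_fst, Prod.smul_snd, LinearMap.smul_comp, LinearMap.comp_smul]
      rw [ha4]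

theorem diagMap_comp_eq_zero_iff (k : Type*) [Field k] (d : Fin 3 → k)
    (φ : k →ₗ[k] (Fin 3 → k)) :
    (diagMap k d).comp φ = 0 ↔ ∀ j, d j = 0 ∨ φ 1 j = 0 := by
  rw [LinearMap.ext_ring_iff, funext_iff]
  simp [diagMap]

theorem mem_linkedTuplesExample_iff (k : Type*) [Field k]
    (φ : (k →ₗ[k] (Fin 3 → k)) × (k →ₗ[k] (Fin 3 → k)) × (k →ₗ[k] (Fin 3 → k))) :
    φ ∈ linkedTuplesExample k ↔ φ.1 1 0 = 0 ∧ φ.2.1 = 0 ∧ φ.2.2 1 2 = 0 := by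
  change (_ = _ ∧ _ = _ ∧ _ = _ ∧ _ = _) ↔ _
  simp only [LinearMap.comp_zero, eq_comm (a := (0 : k →ₗ[k] (Fin 3 → k))),
    diagMap_comp_eq_zero_iff]
  rw [LinearMap.ext_ring_iff (f := φ.2.1), funext_iff]
  simp only [Fin.forall_fin_succ, IsEmpty.forall_iff]
  simp
  tauto

/-- A linked tuple of the example is determined by the last two coordinates of `φ₁` and the
first two coordinates of `φ₃`, which are arbitrary. -/
def linkedTuplesExampleEquiv (k : Type*) [Field k] :
    linkedTuplesExample k ≃ₗ[k] (Fin 4 → k) where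
  toFun φ := ![φ.1.1 1 1, φ.1.1 1 2, φ.1.2.2 1 0, φ.1.2.2 1 1]
  map_add' φ ψ := by simp
  map_smul' c φ := by simp
  invFun v := ⟨(LinearMap.toSpanSingleton k _ ![0, v 0, v 1], 0,
      LinearMap.toSpanSingleton k _ ![v 2, v 3, 0]), by
    simp [mem_linkedTuplesExample_iff]⟩
  left_inv := by
    rintro ⟨⟨φ₁, φ₂, φ₃⟩, h⟩
    obtain ⟨h₁, h₂, h₃⟩ := (mem_linkedTuplesExample_iff k _).1 h
    dsimp only at h₁ h₂ h₃
    refine Subtype.ext (Prod.ext ?_ (Prod.ext h₂.symm ?_))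
    · refine LinearMap.ext_ring (funext fun j => ?_)
      fin_cases j <;> simp [h₁]
    · refine LinearMap.ext_ring (funext fun j => ?_)
      fin_cases j <;> simp [h₃]
  right_inv v := by
    ext j
    fin_cases j <;> simp

/-- The space of linked tuples of the example has dimension `4`, which exceeds
`r·m = 1·3 = 3`. -/
theorem finrank_linkedTuplesExample (k : Type*) [Field k] :
    Module.finrank k (linkedTuplesExample k) = 4 ∧
      1 * 3 < Module.finrank k (linkedTuplesExample k) := by
  have h : Module.finrank k (linkedTuplesExample k) = 4 := by
    rw [(linkedTuplesExampleEquiv k).finrank_eq, Module.finrank_fin_fun]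
  exact ⟨h, by rw [h]; norm_num⟩
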